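/- Let n >= 1 be an integer and r0 > 0. There exists a constant C1 >= 0, depending only on n and r0, such that for every r in (0, r0], every eps0 in (0, 1/2], and every measurable function u : S -> R with |u(w)| <= eps0 for all w in S, if the volume constraint Int_S sinh^{2n}( r(1+u(w))/2 ) dH(w) = sinh^{2n}(r/2) * H(S) holds, then | Int_S u dH | <= ( c0(n,r) + eps0 * C1 ) * Int_S u^2 dH, where c0(n,r) = r ( n - 1 + n cosh(r) ) / ( 2 sinh(r) ). -/

import Mathlib

open MeasureTheory Real

theorem aux_sphere_finite (m : ℕ) :
    μH[(m : ℝ)] (Metric.sphere (0 : EuclideanSpace ℝ (Fin (m + 1))) 1) < ⊤ := by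
  classical
  let V : Fin (m + 1) → ℝ → (Fin m → ℝ) → EuclideanSpace ℝ (Fin (m + 1)) :=
    fun i e y => WithLp.toLp 2 (Fin.insertNth (α := fun _ => ℝ) i e y)
  let Φ : Fin (m + 1) → ℝ → (Fin m → ℝ) → EuclideanSpace ℝ (Fin (m + 1)) :=
    fun i e y => ‖V i e y‖⁻¹ • V i e y
  have hfin : ∀ i : Fin (m + 1), ∀ e : ℝ, e ≠ 0 →
      μH[(m : ℝ)] (Φ i e '' Metric.closedBall 0 1) < ⊤ := by
    intro i e he
    have hV : ContDiff ℝ 1 (V i e) := by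
      rw [contDiff_euclidean]
      intro j
      refine Fin.succAboveCases i ?_ (fun k => ?_) j
      · simp only [V, Fin.insertNth_apply_same]
        exact contDiff_const
      · simp only [V, Fin.insertNth_apply_succAbove]
        exact contDiff_apply ℝ ℝ k
    have hne : ∀ y, V i e y ≠ 0 := by
      intro y h
      have := congrArg (fun v : EuclideanSpace ℝ (Fin (m+1)) => v i) h
      simp [V] at this
      exact he this
    have hΦ : ContDiff ℝ 1 (Φ i e) :=
      ((hV.norm ℝ hne).inv (fun y => norm_ne_zero_iff.2 (hne y))).smul hV
    have hl : LocallyLipschitz (Φ i e) := fun x => hΦ.contDiffAt.exists_lipschitzOnWith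
    obtain ⟨K, hK⟩ := (hl.locallyLipschitzOn (s := Metric.closedBall 0 1)).exists_lipschitzOnWith_of_compact
      (isCompact_closedBall (0 : Fin m → ℝ) 1)
    refine (hK.hausdorffMeasure_image_le (d := m) (by positivity)).trans_lt ?_
    have h2 : (μH[(m : ℝ)] : Measure (Fin m → ℝ)) = volume := by
      have := hausdorffMeasure_pi_real (ι := Fin m)
      simpa using this
    rw [h2]
    exact ENNReal.mul_lt_top (ENNReal.rpow_lt_top_of_nonneg (by positivity) (by simp))
      (isCompact_closedBall (0 : Fin m → ℝ) 1).measure_lt_top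
  have hsub : Metric.sphere (0 : EuclideanSpace ℝ (Fin (m + 1))) 1 ⊆
      ⋃ i : Fin (m + 1), (Φ i 1 '' Metric.closedBall 0 1 ∪ Φ i (-1) '' Metric.closedBall 0 1) := by
    intro w hw
    have hw1 : ‖w‖ = 1 := by simpa using hw
    obtain ⟨i, hi⟩ := Finite.exists_max (fun i => |w i|)
    have hpos : 0 < |w i| := by
      rcases (abs_nonneg (w i)).eq_or_lt with h | h
      · exfalso
        have : w = 0 := by
          ext j
          have := hi j
          rw [← h] at this
          simpa using this
        simp [this] at hw1
      · exact h
    have key : w ∈ Φ i (w i / |w i|) '' Metric.closedBall 0 1 := by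
      refine ⟨fun j => w (i.succAbove j) / |w i|, ?_, ?_⟩
      · rw [mem_closedBall_zero_iff, pi_norm_le_iff_of_nonneg zero_le_one]
        intro j
        rw [norm_div, Real.norm_eq_abs, Real.norm_eq_abs, abs_abs, div_le_one hpos]
        exact hi _
      · have hv : V i (w i / |w i|) (fun j => w (i.succAbove j) / |w i|) = |w i|⁻¹ • w := by
          ext j
          refine Fin.succAboveCases i ?_ (fun k => ?_) j
          · simp [V, div_eq_inv_mul]
          · simp [V, div_eq_inv_mul]
        simp only [Φ, hv, norm_smul, hw1, norm_inv, Real.norm_eq_abs, abs_abs, mul_one, inv_inv, smul_smul]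
        rw [mul_inv_cancel₀ hpos.ne', one_smul]
    refine Set.mem_iUnion.2 ⟨i, ?_⟩
    rcases lt_or_gt_of_ne (abs_pos.1 hpos) with h | h
    · right
      rwa [abs_of_neg h, div_neg, div_self h.ne] at key
    · left
      rwa [abs_of_pos h, div_self h.ne'] at key
  refine (measure_mono hsub).trans_lt ((measure_iUnion_le _).trans_lt ?_)
  rw [tsum_fintype]
  refine ENNReal.sum_lt_top.2 fun i _ => (measure_union_le _ _).trans_lt ?_
  exact ENNReal.add_lt_top.2 ⟨hfin i 1 one_ne_zero, hfin i (-1) (by norm_num)⟩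

theorem aux_taylor (f f1 f2 f3 : ℝ → ℝ) (a d M h : ℝ) (hd : |h| ≤ d)
    (h0 : ∀ x, HasDerivAt f (f1 x) x) (h1 : ∀ x, HasDerivAt f1 (f2 x) x)
    (h2 : ∀ x, HasDerivAt f2 (f3 x) x)
    (hM : ∀ x, |x - a| ≤ d → |f3 x| ≤ M) :
    |f (a + h) - f a - f1 a * h - f2 a / 2 * h ^ 2| ≤ M * |h| ^ 3 := by
  set s : Set ℝ := Set.Icc (a - |h|) (a + |h|) with hs
  have hc : Convex ℝ s := convex_Icc _ _
  have hah : 0 ≤ |h| := abs_nonneg h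
  have has : a ∈ s := ⟨by linarith, by linarith⟩
  have hhs : a + h ∈ s := ⟨by linarith [neg_abs_le h], by linarith [le_abs_self h]⟩
  have hm : ∀ x ∈ s, |x - a| ≤ |h| := fun x hx => abs_le.2 ⟨by linarith [hx.1], by linarith [hx.2]⟩
  have hM0 : 0 ≤ M := (abs_nonneg _).trans (hM a (by simpa using hah.trans hd))
  have b2 : ∀ x ∈ s, |f2 x - f2 a| ≤ M * |h| := by
    intro x hx
    have := hc.norm_image_sub_le_of_norm_hasDerivWithin_le (C := M)
      (fun y _ => (h2 y).hasDerivWithinAt) (fun y hy => hM y ((hm y hy).trans hd)) has hx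
    exact this.trans (mul_le_mul_of_nonneg_left (hm x hx) hM0)
  have b1 : ∀ x ∈ s, |f1 x - f1 a - f2 a * (x - a)| ≤ M * |h| * |h| := by
    intro x hx
    have := hc.norm_image_sub_le_of_norm_hasDerivWithin_le (C := M * |h|)
      (f := fun y => f1 y - f2 a * (y - a)) (f' := fun y => f2 y - f2 a)
      (fun y _ => by
        have := (h1 y).sub (((hasDerivAt_id y).sub_const a).const_mul (f2 a))
        simp only [mul_one] at this
        exact this.hasDerivWithinAt) (fun y hy => b2 y hy) has hx
    have e : f1 x - f1 a - f2 a * (x - a) = f1 x - f2 a * (x - a) - (f1 a - f2 a * (a - a)) := by ring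
    rw [e]
    exact this.trans (mul_le_mul_of_nonneg_left (hm x hx) (by positivity))
  have := hc.norm_image_sub_le_of_norm_hasDerivWithin_le (C := M * |h| * |h|)
      (f := fun y => f y - f1 a * (y - a) - f2 a / 2 * (y - a) ^ 2)
      (f' := fun y => f1 y - f1 a - f2 a * (y - a))
      (fun y _ => by
        have := ((h0 y).sub (((hasDerivAt_id y).sub_const a).const_mul (f1 a))).sub
          ((((hasDerivAt_id y).sub_const a).pow 2).const_mul (f2 a / 2))
        refine (this.congr_deriv ?_).hasDerivWithinAt
        simp
        ring) (fun y hy => b1 y hy) has hhs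
  simp only [Real.norm_eq_abs] at this
  convert this using 1
  · congr 1; ring
  · rw [add_sub_cancel_left]; ring

theorem aux_sinh_le {x : ℝ} (hx : 0 ≤ x) : sinh x ≤ x * cosh x := by
  have := (convex_Icc 0 x).norm_image_sub_le_of_norm_hasDerivWithin_le (C := cosh x)
    (fun y _ => (hasDerivAt_sinh y).hasDerivWithinAt) (fun y hy => by
      rw [Real.norm_eq_abs, abs_of_pos (cosh_pos y), cosh_le_cosh, abs_of_nonneg hy.1, abs_of_nonneg hx]
      exact hy.2) (Set.left_mem_Icc.2 hx) (Set.right_mem_Icc.2 hx)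
  simp only [sinh_zero, sub_zero, Real.norm_eq_abs, abs_of_nonneg hx] at this
  rw [mul_comm]
  exact (le_abs_self _).trans this

/-- Pointwise third order bound. `p = k + 2`, `a = r / 2`. -/
theorem aux_pointwise (k : ℕ) (r0 : ℝ) (a : ℝ) (ha : 0 < a) (har : 2 * a ≤ r0)
    (t : ℝ) (ht : |t| ≤ 1 / 2) :
    |sinh (a + a * t) ^ (k + 2) - sinh a ^ (k + 2)
        - ((k + 2) * sinh a ^ (k + 1) * cosh a) * (a * t)
        - ((k + 2) ^ 2 * sinh a ^ (k + 2) + (k + 2) * (k + 1) * sinh a ^ k) / 2 * (a * t) ^ 2|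
      ≤ (a * ((k + 2) * sinh a ^ (k + 1) * cosh a)) *
        ((cosh r0 * (k + 2) ^ 2 * (r0 ^ 2 + 4) * (2 * cosh r0) ^ (k + 1)) * |t| ^ 3) := by
  set K := cosh r0 with hK
  have hK1 : 1 ≤ K := one_le_cosh _
  set D := ((k : ℝ) + 2) * sinh a ^ (k + 1) * cosh a with hD
  set C := K * (k + 2) ^ 2 * (r0 ^ 2 + 4) * (2 * K) ^ (k + 1) with hC
  have hs : a ≤ sinh a := self_le_sinh_iff.2 ha.le
  have hd : |a * t| ≤ a / 2 := by
    rw [abs_mul, abs_of_pos ha]; nlinarith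
  have main := aux_taylor (fun x => sinh x ^ (k + 2))
    (fun x => (k + 2) * sinh x ^ (k + 1) * cosh x)
    (fun x => (k + 2) ^ 2 * sinh x ^ (k + 2) + (k + 2) * (k + 1) * sinh x ^ k)
    (fun x => (k + 2) ^ 3 * sinh x ^ (k + 1) * cosh x
      + (k + 2) * (k + 1) * (k * sinh x ^ (k - 1) * cosh x))
    a (a / 2) (C * D / a ^ 2) (a * t) hd
    (fun x => by
      have := (hasDerivAt_sinh x).pow (k + 2)
      refine this.congr_deriv ?_
      push_cast
      ring_nf)
    (fun x => by
      have := (((hasDerivAt_sinh x).pow (k + 1)).const_mul ((k : ℝ) + 2)).mul (hasDerivAt_cosh x)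
      refine this.congr_deriv ?_
      have h : cosh x ^ 2 = sinh x ^ 2 + 1 := cosh_sq x
      push_cast
      simp only [Pi.pow_apply]
      linear_combination ((k : ℝ) + 2) * (k + 1) * sinh x ^ k * h)
    (fun x => by
      have := (((hasDerivAt_sinh x).pow (k + 2)).const_mul (((k : ℝ) + 2) ^ 2)).add
        (((hasDerivAt_sinh x).pow k).const_mul (((k : ℝ) + 2) * (k + 1)))
      refine this.congr_deriv ?_
      push_cast
      ring)
    (fun x hx => by
      have hx' := abs_le.1 hx
      have hx0 : 0 < x := by linarith [hx'.1]
      have hxs : x ≤ sinh x := self_le_sinh_iff.2 hx0.le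
      have hs0 : 0 ≤ sinh x := by linarith
      have hcx : cosh x ≤ K := by
        rw [hK, cosh_le_cosh, abs_of_pos hx0]
        exact le_trans (by linarith [hx'.2]) (le_abs_self r0)
      have hc1 : 1 ≤ cosh x := one_le_cosh _
      have hsx : sinh x ≤ 2 * K * sinh a := by
        have h1 := aux_sinh_le hx0.le
        have h2 : x * cosh x ≤ (2 * a) * K :=
          mul_le_mul (by linarith [hx'.2]) hcx (by linarith) (by linarith)
        nlinarith
      have hpow : sinh x ^ (k + 1) ≤ (2 * K) ^ (k + 1) * sinh a ^ (k + 1) := by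
        rw [← mul_pow]; exact pow_le_pow_left₀ hs0 hsx _
      have hk : a ^ 2 * (k * sinh x ^ (k - 1)) ≤ k * (4 * sinh x ^ (k + 1)) := by
        rcases k with _ | k
        · simp
        · simp only [Nat.add_sub_cancel]
          have : a ^ 2 ≤ 4 * sinh x ^ 2 := by
            have : a ≤ 2 * sinh x := by linarith [hx'.1]
            nlinarith
          have h3 := mul_le_mul_of_nonneg_right this
            (show 0 ≤ ((k + 1 : ℕ) : ℝ) * sinh x ^ k by positivity)
          calc _ = a ^ 2 * (((k + 1 : ℕ) : ℝ) * sinh x ^ k) := by ring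
            _ ≤ _ := h3
            _ = _ := by ring
      rw [abs_of_nonneg (by positivity), le_div_iff₀ (by positivity)]
      set S := sinh x ^ (k + 1) with hS
      have hS0 : 0 ≤ S := by positivity
      have ha2 : a ^ 2 ≤ r0 ^ 2 := by nlinarith
      have hkk : ((k : ℝ) + 2) * (k + 1) * k ≤ (k + 2) ^ 3 := by
        have : (0 : ℝ) ≤ k := by positivity
        nlinarith [mul_nonneg this this]
      calc (((k : ℝ) + 2) ^ 3 * S * cosh x
              + (k + 2) * (k + 1) * (k * sinh x ^ (k - 1) * cosh x)) * a ^ 2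
          = cosh x * ((k + 2) ^ 3 * S * a ^ 2
              + (k + 2) * (k + 1) * (a ^ 2 * (k * sinh x ^ (k - 1)))) := by ring
        _ ≤ cosh x * ((k + 2) ^ 3 * S * r0 ^ 2 + (k + 2) * (k + 1) * (k * (4 * S))) := by
            gcongr
        _ = cosh x * ((k + 2) ^ 3 * S * r0 ^ 2 + ((k + 2) * (k + 1) * k) * (4 * S)) := by ring
        _ ≤ K * ((k + 2) ^ 3 * S * r0 ^ 2 + (k + 2) ^ 3 * (4 * S)) := by gcongr
        _ = K * (k + 2) ^ 3 * (r0 ^ 2 + 4) * S := by ring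
        _ ≤ K * (k + 2) ^ 3 * (r0 ^ 2 + 4) * ((2 * K) ^ (k + 1) * sinh a ^ (k + 1)) := by gcongr
        _ = C * ((k + 2) * sinh a ^ (k + 1) * 1) := by rw [hC]; ring
        _ ≤ C * D := by
            rw [hD]
            have : 0 ≤ sinh a := by linarith
            gcongr
            exact one_le_cosh a)
  refine main.trans (le_of_eq ?_)
  rw [abs_mul, abs_of_pos ha]
  field_simp

theorem aux_integral {α : Type*} [MeasurableSpace α] (μ : Measure α) [IsFiniteMeasure μ]
    (u F : α → ℝ) (hu : Integrable u μ) (hu2 : Integrable (fun w => u w ^ 2) μ)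
    (hF : Integrable F μ) (A D c e : ℝ) (hD : 0 < D) (hc : 0 ≤ c)
    (hint : ∫ w, F w ∂μ = A * μ.real Set.univ)
    (hb : ∀ᵐ w ∂μ, |F w - A - D * (u w + c * u w ^ 2)| ≤ D * (e * u w ^ 2)) :
    |∫ w, u w ∂μ| ≤ (c + e) * ∫ w, u w ^ 2 ∂μ := by
  have h1 : |∫ w, (F w - A - D * (u w + c * u w ^ 2)) ∂μ| ≤ ∫ w, D * (e * u w ^ 2) ∂μ :=
    by
    rw [← Real.norm_eq_abs]
    exact norm_integral_le_of_norm_le ((hu2.const_mul e).const_mul D) hb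
  have hi : Integrable (fun w => u w + c * u w ^ 2) μ := hu.add (hu2.const_mul c)
  have hFA : Integrable (fun w => F w - A) μ := hF.sub (integrable_const A)
  rw [integral_sub hFA (hi.const_mul D),
    integral_sub hF (integrable_const A), hint, integral_const, smul_eq_mul,
    integral_const_mul, integral_const_mul, integral_const_mul,
    integral_add hu (hu2.const_mul c), integral_const_mul] at h1
  set U := ∫ w, u w ∂μ
  set Q := ∫ w, u w ^ 2 ∂μ
  have hQ : 0 ≤ Q := integral_nonneg fun w => sq_nonneg _
  rw [show A * μ.real Set.univ - μ.real Set.univ * A - D * (U + c * Q) = -(D * (U + c * Q)) by ring,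
    abs_neg, abs_mul, abs_of_pos hD] at h1
  have h2 := abs_le.1 (le_of_mul_le_mul_left h1 hD)
  rw [abs_le]
  have := mul_nonneg hc hQ
  constructor <;> nlinarith [h2.1, h2.2]

/-- Consequence of the volume constraint: the mean of `u` over the sphere is
quadratically small in `u`. -/
theorem volume_constraint_mean_bound (n : ℕ) (hn : 1 ≤ n) (r0 : ℝ) (hr0 : 0 < r0) :
    ∃ C1 : ℝ, 0 ≤ C1 ∧
      ∀ r : ℝ, 0 < r → r ≤ r0 →
      ∀ eps0 : ℝ, 0 < eps0 → eps0 ≤ 1 / 2 →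
      ∀ u : EuclideanSpace ℝ (Fin (2 * n)) → ℝ,
        Measurable u →
        (∀ w ∈ Metric.sphere (0 : EuclideanSpace ℝ (Fin (2 * n))) 1, |u w| ≤ eps0) →
        (∫ w in Metric.sphere (0 : EuclideanSpace ℝ (Fin (2 * n))) 1,
            Real.sinh (r * (1 + u w) / 2) ^ (2 * n) ∂μH[2 * (n : ℝ) - 1]
          = Real.sinh (r / 2) ^ (2 * n)
              * (μH[2 * (n : ℝ) - 1]
                  (Metric.sphere (0 : EuclideanSpace ℝ (Fin (2 * n))) 1)).toReal) →
        |∫ w in Metric.sphere (0 : EuclideanSpace ℝ (Fin (2 * n))) 1, u w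
            ∂μH[2 * (n : ℝ) - 1]|
          ≤ (r * ((n : ℝ) - 1 + n * Real.cosh r) / (2 * Real.sinh r) + eps0 * C1)
              * ∫ w in Metric.sphere (0 : EuclideanSpace ℝ (Fin (2 * n))) 1, (u w) ^ 2
                  ∂μH[2 * (n : ℝ) - 1] := by
  obtain ⟨k, hk⟩ : ∃ k, 2 * n = k + 2 := ⟨2 * n - 2, by omega⟩
  have hkR : 2 * (n : ℝ) = k + 2 := by exact_mod_cast hk
  have hfin : μH[2 * (n : ℝ) - 1] (Metric.sphere (0 : EuclideanSpace ℝ (Fin (2 * n))) 1) < ⊤ := by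
    have := aux_sphere_finite (k + 1)
    rw [show 2 * (n : ℝ) - 1 = ((k + 1 : ℕ) : ℝ) by push_cast; linarith]
    rw [hk]
    exact this
  refine ⟨cosh r0 * (k + 2) ^ 2 * (r0 ^ 2 + 4) * (2 * cosh r0) ^ (k + 1), ?_, ?_⟩
  · have := cosh_pos r0
    positivity
  intro r hr hrr eps he he2 u hum hub hint
  set C := cosh r0 * (k + 2) ^ 2 * (r0 ^ 2 + 4) * (2 * cosh r0) ^ (k + 1) with hC
  have hC0 : 0 ≤ C := by
    have := cosh_pos r0
    positivity
  set μ := (μH[2 * (n : ℝ) - 1] : Measure (EuclideanSpace ℝ (Fin (2 * n)))).restrict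
    (Metric.sphere 0 1) with hμ
  have : IsFiniteMeasure μ := ⟨by rw [hμ, Measure.restrict_apply_univ]; exact hfin⟩
  have hae : ∀ᵐ w ∂μ, |u w| ≤ eps :=
    (ae_restrict_iff' Metric.isClosed_sphere.measurableSet).2 (Filter.Eventually.of_forall hub)
  obtain ⟨a, rfl⟩ : ∃ a, r = 2 * a := ⟨r / 2, by ring⟩
  have ha : 0 < a := by linarith
  have hsa : 0 < sinh a := sinh_pos_iff.2 ha
  have hca : 0 < cosh a := cosh_pos a
  have hc0 : 2 * a * ((n : ℝ) - 1 + n * cosh (2 * a)) / (2 * sinh (2 * a)) =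
      a * ((k + 2) ^ 2 * sinh a ^ (k + 2) + (k + 2) * (k + 1) * sinh a ^ k) /
        (2 * ((k + 2) * sinh a ^ (k + 1) * cosh a)) := by
    rw [sinh_two_mul, cosh_two_mul, cosh_sq, show (n : ℝ) = (k + 2) / 2 by linarith]
    field_simp
    ring
  have hn1 : (1 : ℝ) ≤ n := by exact_mod_cast hn
  refine aux_integral μ u (fun w => sinh (2 * a * (1 + u w) / 2) ^ (2 * n)) ?_ ?_ ?_
    (sinh (2 * a / 2) ^ (2 * n)) (a * ((k + 2) * sinh a ^ (k + 1) * cosh a)) _ _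
    (by positivity) ?_ ?_ ?_
  · exact Integrable.of_bound hum.aestronglyMeasurable eps hae
  · refine Integrable.of_bound (hum.pow_const 2).aestronglyMeasurable (eps ^ 2) ?_
    filter_upwards [hae] with w hw
    rw [norm_pow, Real.norm_eq_abs]
    exact pow_le_pow_left₀ (abs_nonneg _) hw 2
  · refine Integrable.of_bound ?_ (sinh (2 * a) ^ (2 * n)) ?_
    · exact (((((hum.const_add 1).const_mul (2 * a)).div_const 2).sinh).pow_const _).aestronglyMeasurable
    · filter_upwards [hae] with w hw
      rw [norm_pow, Real.norm_eq_abs, abs_sinh]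
      refine pow_le_pow_left₀ (sinh_nonneg_iff.2 (abs_nonneg _)) (sinh_le_sinh.2 ?_) _
      have := abs_le.1 hw
      rw [abs_le]
      constructor <;> nlinarith
  · have := cosh_pos (2 * a)
    have h2 : 0 < sinh (2 * a) := sinh_pos_iff.2 hr
    have : 0 ≤ (n : ℝ) - 1 := by linarith
    positivity
  · rw [hint, Measure.real, hμ, Measure.restrict_apply_univ]
  · filter_upwards [hae] with w hw
    have := aux_pointwise k r0 a ha hrr (u w) (hw.trans he2)
    rw [← hC] at this
    rw [hc0, hk, show 2 * a * (1 + u w) / 2 = a + a * u w by ring, show 2 * a / 2 = a by ring]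
    have h3 : |u w| ^ 3 * C ≤ eps * C * u w ^ 2 := by
      rw [← sq_abs (u w)]
      have := mul_le_mul_of_nonneg_right hw (show 0 ≤ |u w| ^ 2 * C by positivity)
      nlinarith
    refine le_trans (le_of_eq_of_le ?_ this) ?_
    · congr 1
      field_simp
      ring
    · refine mul_le_mul_of_nonneg_left ?_ (by positivity)
      linarith
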